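/- Let G be a minor-minimal enemy and let uv ∈ E(G) be an edge such that v has degree 4 in G. Then there exists a vertex w ∈ V(G) of degree 4 such that vw ∈ E(G) and uw ∈ E(G). -/

import Mathlib

open SimpleGraph

/-- `K7vee` is the graph obtained from `K 7` by deleting two edges with a common end. -/
def K7vee : SimpleGraph (Fin 7) :=
  (completeGraph (Fin 7)).deleteEdges {s(0, 1), s(0, 2)}

/-- `K6vee` is the graph obtained from `K 6` by deleting two edges with a common end. -/
def K6vee : SimpleGraph (Fin 6) :=
  (completeGraph (Fin 6)).deleteEdges {s(0, 1), s(0, 2)}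

/-- The complete multipartite graph with four parts of size two. -/
def K2222 : SimpleGraph (Fin 4 × Fin 2) :=
  SimpleGraph.comap Prod.fst (completeGraph (Fin 4))

/-- `H` is a minor of `G`: there is a model of `H` in `G`, i.e. a family of pairwise disjoint
nonempty connected branch sets, one for each vertex of `H`, with edges of `G` between branch
sets corresponding to adjacent vertices of `H`. -/
def IsMinor {W V : Type} (H : SimpleGraph W) (G : SimpleGraph V) : Prop :=
  ∃ bag : W → Set V,
    (∀ w, (G.induce (bag w)).Connected) ∧
    (∀ w w', w ≠ w' → Disjoint (bag w) (bag w')) ∧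
    (∀ w w', H.Adj w w' → ∃ u ∈ bag w, ∃ v ∈ bag w', G.Adj u v)

/-- A graph is `k`-connected if it has more than `k` vertices and stays connected after
removing any set of fewer than `k` vertices. -/
def IsKConnected {V : Type} [Fintype V] (k : ℕ) (G : SimpleGraph V) : Prop :=
  k < Fintype.card V ∧ ∀ S : Set V, S.ncard < k → (G.induce (Sᶜ : Set V)).Connected

/-- A separation of `G`: `A ∪ B = V(G)` and no edge joins `A - B` to `B - A`. -/
def IsSeparation {V : Type} (G : SimpleGraph V) (A B : Set V) : Prop :=
  A ∪ B = Set.univ ∧ ∀ ⦃u v : V⦄, G.Adj u v → ¬(u ∈ A \ B ∧ v ∈ B \ A)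

/-- `(G, Z)` is internally `k`-connected: every separation `(A,B)` of `G` with `Z ⊆ A`
and `B - A ≠ ∅` has order at least `k`. -/
def InternallyConnected {V : Type} (G : SimpleGraph V) (Z : Set V) (k : ℕ) : Prop :=
  ∀ A B : Set V, IsSeparation G A B → Z ⊆ A → (B \ A).Nonempty →
    k ≤ (A ∩ B).ncard

/-- A `Z`-rooted `K₄`-model in `G`. -/
def HasRootedK4Model {V : Type} (G : SimpleGraph V) (Z : Set V) : Prop :=
  ∃ B : Fin 4 → Set V,
    (∀ i, (G.induce (B i)).Connected) ∧
    (∀ i j, i ≠ j → Disjoint (B i) (B j)) ∧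
    (∀ i, ∃! z : V, z ∈ Z ∧ z ∈ B i) ∧
    (∀ z ∈ Z, ∃ i, z ∈ B i) ∧
    (∀ i j, i ≠ j → ∃ u ∈ B i, ∃ v ∈ B j, G.Adj u v)

/-- A `Z`-rooted `K*₄,₂`-model in `G`. -/
def HasRootedK42starModel {V : Type} (G : SimpleGraph V) (Z : Set V) : Prop :=
  ∃ (B : Fin 4 → Set V) (C : Fin 2 → Set V),
    (∀ i, (G.induce (B i)).Connected) ∧
    (∀ j, (G.induce (C j)).Connected) ∧
    (∀ i j, i ≠ j → Disjoint (B i) (B j)) ∧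
    (∀ i j, i ≠ j → Disjoint (C i) (C j)) ∧
    (∀ i j, Disjoint (B i) (C j)) ∧
    (∀ i, ∃! z : V, z ∈ Z ∧ z ∈ B i) ∧
    (∀ z ∈ Z, ∃ i, z ∈ B i) ∧
    (∀ i j, ∃ u ∈ B i, ∃ v ∈ C j, G.Adj u v) ∧
    (∃ u ∈ C 0, ∃ v ∈ C 1, G.Adj u v)

/-- An enemy: a `4`-connected graph with `|E(G)| ≥ 4|V(G)| - 8`, with no `K7vee`-minor,
not isomorphic to `K_{2,2,2,2}`. -/
def Enemy {V : Type} [Fintype V] (G : SimpleGraph V) : Prop :=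
  IsKConnected 4 G ∧
    4 * (Fintype.card V : ℤ) - 8 ≤ (G.edgeSet.ncard : ℤ) ∧
    ¬ IsMinor K7vee G ∧
    IsEmpty (G ≃g K2222)

/-- A minor-minimal enemy: an enemy, no minor of which, other than itself, is an enemy. -/
def MinorMinimalEnemy {V : Type} [Fintype V] (G : SimpleGraph V) : Prop :=
  Enemy G ∧ ∀ (W : Type) [Fintype W] (H : SimpleGraph W),
    IsMinor H G → Enemy H → Nonempty (H ≃g G)

/-- The simple graph obtained from `G` by contracting the edge `uv`
(`v` is merged into `u`). -/
def contractEdge {V : Type} (G : SimpleGraph V) (u v : V) :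
    SimpleGraph {x : V // x ≠ v} :=
  SimpleGraph.fromRel (fun x y => G.Adj ↑x ↑y ∨ ((x : V) = u ∧ G.Adj v ↑y))

/-- A graph is `7`-contraction-critical if its chromatic number is `7` and
every minor of it, other than itself, has chromatic number less than `7`. -/
def ContractionCritical7 {V : Type} [Fintype V] (G : SimpleGraph V) : Prop :=
  G.chromaticNumber = 7 ∧
    ∀ (W : Type) [Fintype W] (H : SimpleGraph W),
      IsMinor H G → IsEmpty (H ≃g G) → H.chromaticNumber < 7

theorem induce_connected_iff_forall_closed {V : Type} {G : SimpleGraph V} {s : Set V} :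
    (G.induce s).Connected ↔ s.Nonempty ∧ ∀ A ⊆ s, A.Nonempty →
      (∀ x ∈ A, ∀ y ∈ s, G.Adj x y → y ∈ A) → s ⊆ A := by
  constructor
  · intro h
    refine ⟨Set.nonempty_coe_sort.mp h.nonempty, ?_⟩
    rintro A hA ⟨x, hx⟩ hcl y hy
    by_contra hyA
    obtain ⟨p⟩ := h.preconnected ⟨x, hA hx⟩ ⟨y, hy⟩
    obtain ⟨d, -, hd₁, hd₂⟩ := p.exists_boundary_dart {z : s | (z : V) ∈ A} hx hyA
    exact hd₂ (hcl _ hd₁ _ d.snd.2 d.adj)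
  · rintro ⟨⟨x₀, hx₀⟩, h⟩
    have : Nonempty s := ⟨⟨x₀, hx₀⟩⟩
    refine ⟨fun x y => ?_⟩
    have key := h {z | ∃ hz : z ∈ s, (G.induce s).Reachable x ⟨z, hz⟩}
      (fun z hz => hz.1) ⟨x, x.2, Reachable.refl _⟩
      (fun z ⟨hz, hr⟩ w hw hzw =>
        ⟨hw, hr.trans (Adj.reachable (G := G.induce s) (u := ⟨z, hz⟩) (v := ⟨w, hw⟩) hzw)⟩)
    exact (key y.2).2

theorem induce_pair_connected {V : Type} {G : SimpleGraph V} {x y : V} (h : x = y ∨ G.Adj x y) :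
    (G.induce {x, y}).Connected := by
  rcases h with rfl | h
  · rw [induce_connected_iff_forall_closed]
    refine ⟨⟨x, by simp⟩, ?_⟩
    rintro A hA ⟨z, hz⟩ -
    obtain rfl : z = x := by simpa using hA hz
    simpa using hz
  · exact induce_pair_connected_of_adj h

theorem IsMinor.trans {U V W : Type} {F : SimpleGraph U} {G : SimpleGraph V} {H : SimpleGraph W}
    (hFG : IsMinor F G) (hGH : IsMinor G H) : IsMinor F H := by
  obtain ⟨b, hb, hb_disj, hb_adj⟩ := hFG
  obtain ⟨c, hc, hc_disj, hc_adj⟩ := hGH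
  simp only [induce_connected_iff_forall_closed] at hb hc
  refine ⟨fun w => ⋃ v ∈ b w, c v, fun w => ?_, fun w w' hw => ?_, fun w w' hw => ?_⟩
  · rw [induce_connected_iff_forall_closed]
    obtain ⟨v, hv⟩ := (hb w).1
    obtain ⟨x, hx⟩ := (hc v).1
    refine ⟨⟨x, Set.mem_biUnion hv hx⟩, ?_⟩
    rintro A hA ⟨y, hy⟩ hcl
    have hfill : ∀ v ∈ b w, (A ∩ c v).Nonempty → c v ⊆ A := fun v hv hne =>
      ((hc v).2 (A ∩ c v) Set.inter_subset_right hne fun x hx y hy hxy =>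
        ⟨hcl x hx.1 y (Set.mem_biUnion hv hy) hxy, hy⟩).trans Set.inter_subset_left
    have hall := (hb w).2 {v ∈ b w | (A ∩ c v).Nonempty} (fun v hv => hv.1)
      (by
        obtain ⟨v, hv, hyv⟩ := Set.mem_iUnion₂.mp (hA hy)
        exact ⟨v, hv, y, hy, hyv⟩)
      (by
        rintro v ⟨hv, hne⟩ v' hv' hadj
        obtain ⟨p, hp, q, hq, hpq⟩ := hc_adj v v' hadj
        exact ⟨hv', q, hcl p (hfill v hv hne hp) q (Set.mem_biUnion hv' hq) hpq, hq⟩)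
    exact Set.iUnion₂_subset fun v hv => hfill v hv (hall hv).2
  · simp only [Set.disjoint_iUnion_left, Set.disjoint_iUnion_right]
    intro v hv v' hv'
    exact hc_disj _ _ fun h => Set.disjoint_left.mp (hb_disj w w' hw) hv' (h ▸ hv)
  · obtain ⟨v, hv, v', hv', hadj⟩ := hb_adj w w' hw
    obtain ⟨p, hp, q, hq, hpq⟩ := hc_adj v v' hadj
    exact ⟨p, Set.mem_biUnion hv hp, q, Set.mem_biUnion hv' hq, hpq⟩

/-- A set `N` separating a vertex of `X` from a vertex outside `X` has at least four vertices. -/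
theorem IsKConnected.four_le_card {V : Type} [Fintype V] {G : SimpleGraph V}
    (hG : IsKConnected 4 G) {X N : Finset V} (hX : ∃ x ∈ X, x ∉ N)
    (hcl : ∀ x ∈ X, ∀ y, G.Adj x y → y ∈ X ∨ y ∈ N) (hz : ∃ z, z ∉ X ∧ z ∉ N) :
    4 ≤ N.card := by
  by_contra! hlt
  obtain ⟨x, hx, hxN⟩ := hX
  obtain ⟨z, hzX, hzN⟩ := hz
  have h := (induce_connected_iff_forall_closed.mp
    (hG.2 N (by rwa [Set.ncard_coe_finset]))).2 {y | y ∈ X ∧ y ∉ N} (fun y hy => by simpa using hy.2)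
    ⟨x, hx, hxN⟩ (fun y hy y' hy' hadj => ⟨(hcl y hy.1 y' hadj).resolve_right (by simpa using hy'),
      by simpa using hy'⟩)
  exact hzX (h (show z ∈ (N : Set V)ᶜ by simpa using hzN)).1

/-- A partition of the vertices into nonempty sides `X`, `Y` and a set `C` of four vertices
separating them. -/
structure IsFourCut {V : Type} (G : SimpleGraph V) (X C Y : Finset V) : Prop where
  cover : ∀ x, x ∈ X ∨ x ∈ C ∨ x ∈ Y
  disjoint_left : Disjoint X C
  disjoint_right : Disjoint Y C
  disjoint_sides : Disjoint X Y
  not_adj : ∀ x ∈ X, ∀ y ∈ Y, ¬ G.Adj x y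
  left_nonempty : X.Nonempty
  right_nonempty : Y.Nonempty
  card_eq : C.card = 4

namespace IsFourCut

variable {V : Type} {G : SimpleGraph V} {X C Y D T D' : Finset V} {a u v w : V}

theorem symm (h : IsFourCut G X C Y) : IsFourCut G Y C X where
  cover x := by have := h.cover x; tauto
  disjoint_left := h.disjoint_right
  disjoint_right := h.disjoint_left
  disjoint_sides := h.disjoint_sides.symm
  not_adj x hx y hy hxy := h.not_adj y hy x hx hxy.symm
  left_nonempty := h.right_nonempty
  right_nonempty := h.left_nonempty
  card_eq := h.card_eq

theorem mem_or_mem_of_adj (h : IsFourCut G X C Y) {x y : V} (hx : x ∈ X) (hxy : G.Adj x y) :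
    y ∈ X ∨ y ∈ C := by
  rcases h.cover y with hy | hy | hy
  · exact .inl hy
  · exact .inr hy
  · exact absurd hxy (h.not_adj x hx y hy)

theorem notMem_of_mem_left (h : IsFourCut G X C Y) {x : V} (hx : x ∈ X) : x ∉ C ∧ x ∉ Y :=
  ⟨Finset.disjoint_left.mp h.disjoint_left hx, Finset.disjoint_left.mp h.disjoint_sides hx⟩

theorem card_eq_add [DecidableEq V] (h : IsFourCut G X C Y) (Z : Finset V) :
    Z.card = (Z ∩ X).card + (Z ∩ C).card + (Z ∩ Y).card := by
  have hd : Disjoint (Z ∩ X ∪ Z ∩ C) (Z ∩ Y) := by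
    rw [Finset.disjoint_union_left]
    exact ⟨h.disjoint_sides.mono Finset.inter_subset_right Finset.inter_subset_right,
      h.disjoint_right.symm.mono Finset.inter_subset_right Finset.inter_subset_right⟩
  rw [← Finset.card_union_of_disjoint
    (h.disjoint_left.mono Finset.inter_subset_right Finset.inter_subset_right),
    ← Finset.card_union_of_disjoint hd]
  congr 1
  ext x
  have := h.cover x
  simp only [Finset.mem_union, Finset.mem_inter]
  tauto

variable [Fintype V]

theorem exists_adj_left (hG : IsKConnected 4 G) (h : IsFourCut G X C Y) (hv : v ∈ C) :
    ∃ x ∈ X, G.Adj v x := by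
  classical
  by_contra! hno
  obtain ⟨x, hx⟩ := h.left_nonempty
  obtain ⟨y, hy⟩ := h.right_nonempty
  have := hG.four_le_card (X := X) (N := C.erase v)
    ⟨x, hx, fun hx' => (h.notMem_of_mem_left hx).1 (Finset.mem_of_mem_erase hx')⟩
    (fun z hz y hzy => (h.mem_or_mem_of_adj hz hzy).imp_right fun hy =>
      Finset.mem_erase.mpr ⟨fun hyv => hno z hz (hyv ▸ hzy.symm), hy⟩)
    ⟨y, (h.symm.notMem_of_mem_left hy).2,
      fun hy' => (h.symm.notMem_of_mem_left hy).1 (Finset.mem_of_mem_erase hy')⟩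
  rw [Finset.card_erase_of_mem hv, h.card_eq] at this
  omega

theorem exists_adj_right (hG : IsKConnected 4 G) (h : IsFourCut G X C Y) (hv : v ∈ C) :
    ∃ y ∈ Y, G.Adj v y :=
  h.symm.exists_adj_left hG hv

theorem neighborFinset_eq_of_singleton [DecidableRel G.Adj] (hG : IsKConnected 4 G) (h : IsFourCut G {w} C Y) :
    G.neighborFinset w = C := by
  obtain ⟨y, hy⟩ := h.right_nonempty
  obtain ⟨hyC, hyX⟩ := h.symm.notMem_of_mem_left hy
  have hsub : G.neighborFinset w ⊆ C := fun z hz => by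
    rw [mem_neighborFinset] at hz
    refine (h.mem_or_mem_of_adj (Finset.mem_singleton_self w) hz).resolve_left fun hzw => ?_
    exact G.ne_of_adj hz (Finset.mem_singleton.mp hzw).symm
  refine Finset.eq_of_subset_of_card_le hsub ?_
  rw [h.card_eq]
  refine hG.four_le_card (X := {w}) ⟨w, by simp, by simp⟩ ?_ ⟨y, hyX, fun hy' => hyC (hsub hy')⟩
  intro x hx z hxz
  rw [Finset.mem_singleton] at hx
  subst hx
  exact .inr ((mem_neighborFinset _ _ _).mpr hxz)

variable [DecidableEq V]

/-- The vertices around a nonempty corner `X ∩ D` of two crossing cuts. -/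
theorem four_le_corner (hG : IsKConnected 4 G) (h : IsFourCut G X C Y) (h' : IsFourCut G D T D')
    (hne : (X ∩ D).Nonempty) : 4 ≤ (C ∩ D).card + (C ∩ T).card + (X ∩ T).card := by
  obtain ⟨x, hx⟩ := hne
  obtain ⟨y, hy⟩ := h.right_nonempty
  obtain ⟨hyC, hyX⟩ := h.symm.notMem_of_mem_left hy
  rw [Finset.mem_inter] at hx
  have h1 := (h.notMem_of_mem_left hx.1).1
  have h2 := (h'.notMem_of_mem_left hx.2).1
  have := hG.four_le_card (X := X ∩ D) (N := C ∩ D ∪ C ∩ T ∪ X ∩ T)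
    ⟨x, Finset.mem_inter.mpr hx, by simp [h1, h2]⟩
    (fun z hz w hzw => by
      rw [Finset.mem_inter] at hz
      have h3 := h.mem_or_mem_of_adj hz.1 hzw
      have h4 := h'.mem_or_mem_of_adj hz.2 hzw
      simp only [Finset.mem_union, Finset.mem_inter]
      tauto)
    ⟨y, by simp [hyX], by simp [hyC, hyX]⟩
  have h3 := Finset.card_union_le (C ∩ D ∪ C ∩ T) (X ∩ T)
  have h4 := Finset.card_union_le (C ∩ D) (C ∩ T)
  omega

/-- If a common vertex `v` of two crossing cuts has no neighbour in the nonempty corner `X ∩ D`,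
then there are at least five vertices around that corner. -/
theorem five_le_corner (hG : IsKConnected 4 G) (h : IsFourCut G X C Y) (h' : IsFourCut G D T D')
    (hvC : v ∈ C) (hvT : v ∈ T) (hv : ∀ x ∈ X, x ∈ D → ¬ G.Adj x v)
    (hne : (X ∩ D).Nonempty) : 5 ≤ (C ∩ D).card + (C ∩ T).card + (X ∩ T).card := by
  obtain ⟨x, hx⟩ := hne
  obtain ⟨y, hy⟩ := h.right_nonempty
  obtain ⟨hyC, hyX⟩ := h.symm.notMem_of_mem_left hy
  rw [Finset.mem_inter] at hx
  have h1 := (h.notMem_of_mem_left hx.1).1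
  have h2 := (h'.notMem_of_mem_left hx.2).1
  have := hG.four_le_card (X := X ∩ D) (N := (C ∩ D ∪ C ∩ T ∪ X ∩ T).erase v)
    ⟨x, Finset.mem_inter.mpr hx, by simp [h1, h2]⟩
    (fun z hz w hzw => by
      rw [Finset.mem_inter] at hz
      have h3 := h.mem_or_mem_of_adj hz.1 hzw
      have h4 := h'.mem_or_mem_of_adj hz.2 hzw
      have h5 : w ≠ v := fun hwv => hv z hz.1 hz.2 (hwv ▸ hzw)
      simp only [Finset.mem_erase, Finset.mem_union, Finset.mem_inter]
      tauto)
    ⟨y, by simp [hyX], by simp [hyC, hyX]⟩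
  rw [Finset.card_erase_of_mem (by simp [hvC, hvT])] at this
  have h3 := Finset.card_union_le (C ∩ D ∪ C ∩ T) (X ∩ T)
  have h4 := Finset.card_union_le (C ∩ D) (C ∩ T)
  omega

/-- If the side `D'` of a crossing cut lies in `C`, then every vertex of `D'` has a neighbour
in `Y ∩ T`. -/
theorem inter_nonempty_of_subset (hG : IsKConnected 4 G) (h : IsFourCut G X C Y)
    (h' : IsFourCut G D T D') (hXD : X ∩ D' = ∅) (hYD : Y ∩ D' = ∅) :
    1 ≤ (Y ∩ T).card := by
  obtain ⟨w, hw⟩ := h'.right_nonempty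
  have hwC : w ∈ C := by
    rcases h.cover w with hw' | hw' | hw'
    · exact absurd (Finset.mem_inter.mpr ⟨hw', hw⟩) (by simp [hXD])
    · exact hw'
    · exact absurd (Finset.mem_inter.mpr ⟨hw', hw⟩) (by simp [hYD])
  obtain ⟨y, hy, hwy⟩ := h.exists_adj_right hG hwC
  have hyT : y ∈ T := (h'.symm.mem_or_mem_of_adj hw hwy).resolve_left
    fun hy' => absurd (Finset.mem_inter.mpr ⟨hy, hy'⟩) (by simp [hYD])
  exact Finset.card_pos.mpr ⟨y, Finset.mem_inter.mpr ⟨hy, hyT⟩⟩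

variable [DecidableRel G.Adj]

theorem exists_of_small_side (hG : IsKConnected 4 G) (h : IsFourCut G X C Y)
    (h' : IsFourCut G D T D') (hXD : X ∩ D' = ∅) (hYD : Y ∩ D' = ∅) (hCD : (C ∩ D').card ≤ 1)
    (hXT : 2 ≤ (X ∩ T).card) (hvC : v ∈ C) (hvT : v ∈ T) (haT : a ∈ T) :
    ∃ w ∈ C, G.neighborFinset w ∩ C = {v} ∧ (G.neighborFinset w ∩ X).card = 2 ∧
      (G.neighborFinset w ∩ Y).card = 1 ∧ G.Adj w a := by
  have h1 := h.inter_nonempty_of_subset hG h' hXD hYD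
  have h2 : 1 ≤ (C ∩ T).card := Finset.card_pos.mpr ⟨v, Finset.mem_inter.mpr ⟨hvC, hvT⟩⟩
  have h3 := h.card_eq_add T
  have h4 := h.card_eq_add D'
  rw [Finset.inter_comm T X, Finset.inter_comm T C, Finset.inter_comm T Y, h'.card_eq] at h3
  rw [Finset.inter_comm D' X, Finset.inter_comm D' C, Finset.inter_comm D' Y, hXD, hYD,
    Finset.card_empty] at h4
  have h5 := h'.right_nonempty.card_pos
  obtain ⟨w, rfl⟩ := Finset.card_eq_one.mp (show D'.card = 1 by omega)
  have hwC : w ∈ C := by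
    have : 0 < (C ∩ {w}).card := by omega
    obtain ⟨x, hx⟩ := Finset.card_pos.mp this
    rw [Finset.mem_inter, Finset.mem_singleton] at hx
    exact hx.2 ▸ hx.1
  have hN := h'.symm.neighborFinset_eq_of_singleton hG
  refine ⟨w, hwC, ?_, ?_, ?_, ?_⟩
  · rw [hN]
    obtain ⟨z, hz⟩ := Finset.card_eq_one.mp (show (T ∩ C).card = 1 by
      rw [Finset.inter_comm]; omega)
    have : v ∈ T ∩ C := Finset.mem_inter.mpr ⟨hvT, hvC⟩
    rw [hz, Finset.mem_singleton] at this
    rw [hz, this]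
  · rw [hN, Finset.inter_comm]; omega
  · rw [hN, Finset.inter_comm]; omega
  · rwa [← mem_neighborFinset, hN]

/-- If `v ∈ C` has a unique neighbour `a` in the side `X` of a four-cut, `X` is not a singleton
and `v`, `a` lie in a common four-cut, then `C` contains a vertex of degree four whose
neighbourhood is distributed in a prescribed way. -/
theorem exists_degree_four (hG : IsKConnected 4 G) (h : IsFourCut G X C Y)
    (h' : IsFourCut G D T D') (hX : 2 ≤ X.card) (hvC : v ∈ C) (hvT : v ∈ T) (haX : a ∈ X)
    (haT : a ∈ T) (huniq : ∀ x ∈ X, G.Adj v x → x = a) :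
    ∃ w ∈ C, G.neighborFinset w ∩ C = {v} ∧ (G.neighborFinset w ∩ X).card = 2 ∧
      (G.neighborFinset w ∩ Y).card = 1 ∧ G.Adj w a := by
  have hCT : 1 ≤ (C ∩ T).card := Finset.card_pos.mpr ⟨v, Finset.mem_inter.mpr ⟨hvC, hvT⟩⟩
  have hXT : 1 ≤ (X ∩ T).card := Finset.card_pos.mpr ⟨a, Finset.mem_inter.mpr ⟨haX, haT⟩⟩
  have hC := h'.card_eq_add C
  have hT := h.card_eq_add T
  rw [Finset.inter_comm T X, Finset.inter_comm T C, Finset.inter_comm T Y, h'.card_eq] at hT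
  rw [h.card_eq] at hC
  have hcorner : ∀ {D D' : Finset V}, IsFourCut G D T D' → (X ∩ D).Nonempty →
      5 ≤ (C ∩ D).card + (C ∩ T).card + (X ∩ T).card := fun h'' =>
    h.five_le_corner hG h'' hvC hvT fun x hx hxD hxv =>
      (h''.notMem_of_mem_left hxD).1 (huniq x hx hxv.symm ▸ haT)
  have hopp : ∀ {D D' : Finset V}, IsFourCut G D T D' →
      (C ∩ D).card + (C ∩ T).card + (Y ∩ T).card ≤ 3 → Y ∩ D = ∅ := fun h'' hle => by
    by_contra hne
    have := h.symm.four_le_corner hG h'' (Finset.nonempty_iff_ne_empty.mpr hne)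
    omega
  have hside : ∀ {D D' : Finset V}, IsFourCut G D T D' →
      4 = (C ∩ D).card + (C ∩ T).card + (C ∩ D').card →
      (X ∩ D).Nonempty → X ∩ D' = ∅ →
      ∃ w ∈ C, G.neighborFinset w ∩ C = {v} ∧ (G.neighborFinset w ∩ X).card = 2 ∧
      (G.neighborFinset w ∩ Y).card = 1 ∧ G.Adj w a := fun {D D'} h'' hC hne hXD => by
    have h1 := hcorner h'' hne
    have h2 := hopp h''.symm (by omega)
    have h3 := h.inter_nonempty_of_subset hG h'' hXD h2
    have h4 := h.card_eq_add D'
    rw [Finset.inter_comm D' X, Finset.inter_comm D' C, Finset.inter_comm D' Y, hXD, h2,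
      Finset.card_empty] at h4
    have h5 := h''.right_nonempty.card_pos
    exact h.exists_of_small_side hG h'' hXD h2 (by omega) (by omega) hvC hvT haT
  rcases Finset.eq_empty_or_nonempty (X ∩ D) with hD | hD <;>
    rcases Finset.eq_empty_or_nonempty (X ∩ D') with hD' | hD'
  · have h1 := h'.card_eq_add X
    rw [hD, hD', Finset.card_empty] at h1
    by_cases h2 : (C ∩ D').card ≤ 1
    · exact h.exists_of_small_side hG h' hD' (hopp h'.symm (by omega)) h2 (by omega) hvC hvT haT
    · exact h.exists_of_small_side hG h'.symm hD (hopp h' (by omega)) (by omega) (by omega)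
        hvC hvT haT
  · exact hside h'.symm (by omega) hD' hD
  · exact hside h' hC hD hD'
  · have h1 := hcorner h' hD
    have h2 := hcorner h'.symm hD'
    have h3 := hopp h' (by omega)
    have h4 := hopp h'.symm (by omega)
    have h5 := h'.card_eq_add Y
    rw [h3, h4, Finset.card_empty] at h5
    have h6 := h.right_nonempty.card_pos
    omega

/-- The neighbourhood of `u` when `uv` is an edge in `C`, `v` has degree four and no common
neighbour of degree four with `u`, and a single neighbour in `X`. -/
theorem neighborFinset_of_no_common_neighbor (hG : IsKConnected 4 G)
    (hcut : ∀ x y, G.Adj x y → G.degree y = 4 → ∃ D T D', IsFourCut G D T D' ∧ x ∈ T ∧ y ∈ T)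
    (huv : G.Adj u v) (hv : G.degree v = 4)
    (hbad : ∀ w, G.degree w = 4 → G.Adj v w → ¬ G.Adj u w)
    (h : IsFourCut G X C Y) (huC : u ∈ C) (hvC : v ∈ C)
    (hone : (G.neighborFinset v ∩ X).card = 1) :
    G.neighborFinset u ∩ C = {v} ∧ (G.neighborFinset u ∩ X).card = 2 ∧
      (G.neighborFinset u ∩ Y).card = 1 ∧ ∀ a ∈ X, G.Adj v a → G.Adj u a := by
  have key : ∀ {X Y : Finset V} {u v : V}, IsFourCut G X C Y → u ∈ C → v ∈ C →
      G.degree v = 4 → (∀ w, G.degree w = 4 → G.Adj v w → ¬ G.Adj u w) →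
      (G.neighborFinset v ∩ X).card = 1 →
      ∃ w ∈ C, G.neighborFinset w ∩ C = {v} ∧ (G.neighborFinset w ∩ X).card = 2 ∧
      (G.neighborFinset w ∩ Y).card = 1 ∧ ∀ a ∈ X, G.Adj v a → G.Adj w a := by
    intro X Y u v h huC hvC hv hbad hone
    have hX : 2 ≤ X.card := by
      by_contra! hlt
      have := h.left_nonempty.card_pos
      obtain ⟨w, rfl⟩ := Finset.card_eq_one.mp (show X.card = 1 by omega)
      have hN := h.neighborFinset_eq_of_singleton hG
      refine hbad w (by rw [← card_neighborFinset_eq_degree, hN, h.card_eq]) ?_ ?_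
      · exact G.adj_symm ((mem_neighborFinset _ _ _).mp (hN ▸ hvC))
      · exact G.adj_symm ((mem_neighborFinset _ _ _).mp (hN ▸ huC))
    obtain ⟨a, ha⟩ := Finset.card_eq_one.mp hone
    have haX : G.Adj v a ∧ a ∈ X := by
      simpa using ha.ge (Finset.mem_singleton_self a)
    have huniq : ∀ x ∈ X, G.Adj v x → x = a := fun x hx hvx => by
      simpa using ha.le (Finset.mem_inter.mpr ⟨(mem_neighborFinset _ _ _).mpr hvx, hx⟩)
    obtain ⟨D, T, D', h', haT, hvT⟩ := hcut a v haX.1.symm hv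
    obtain ⟨w, hwC, h1, h2, h3, h4⟩ := h.exists_degree_four hG h' hX hvC hvT haX.2 haT huniq
    exact ⟨w, hwC, h1, h2, h3, fun x hx hvx => huniq x hx hvx ▸ h4⟩
  obtain ⟨w, hwC, h1, h2, h3, h4⟩ := key h huC hvC hv hbad hone
  by_cases hwu : w = u
  · subst hwu
    exact ⟨h1, h2, h3, h4⟩
  exfalso
  have hvw : G.Adj v w :=
    G.adj_symm (by simpa using (Finset.mem_inter.mp (h1.ge (Finset.mem_singleton_self v))).1)
  have hvY : (G.neighborFinset v ∩ Y).card = 1 := by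
    have hsum := h.card_eq_add (G.neighborFinset v)
    rw [card_neighborFinset_eq_degree, hv] at hsum
    have h5 : 2 ≤ (G.neighborFinset v ∩ C).card := by
      rw [← Finset.card_pair hwu]
      refine Finset.card_le_card fun x hx => ?_
      rw [Finset.mem_insert, Finset.mem_singleton] at hx
      rcases hx with rfl | rfl
      · simpa using ⟨hvw, hwC⟩
      · simpa using ⟨huv.symm, huC⟩
    obtain ⟨y, hy, hvy⟩ := h.exists_adj_right hG hvC
    have h6 : 0 < (G.neighborFinset v ∩ Y).card :=
      Finset.card_pos.mpr ⟨y, by simpa using ⟨hvy, hy⟩⟩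
    omega
  obtain ⟨w', hw'C, h1', h2', h3', -⟩ := key h.symm huC hvC hv hbad hvY
  have hw'v : G.Adj v w' :=
    G.adj_symm (by simpa using (Finset.mem_inter.mp (h1'.ge (Finset.mem_singleton_self v))).1)
  have hw'w : w' ≠ w := by rintro rfl; omega
  have hw'u : w' = u := by
    by_contra hne
    have hsum := h.card_eq_add (G.neighborFinset v)
    rw [card_neighborFinset_eq_degree, hv, hone, hvY] at hsum
    have h5 : ({w, u, w'} : Finset V).card ≤ (G.neighborFinset v ∩ C).card := by
      refine Finset.card_le_card fun x hx => ?_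
      simp only [Finset.mem_insert, Finset.mem_singleton] at hx
      rcases hx with rfl | rfl | rfl
      · simpa using ⟨hvw, hwC⟩
      · simpa using ⟨huv.symm, huC⟩
      · simpa using ⟨hw'v, hw'C⟩
    rw [Finset.card_eq_three.mpr ⟨w, u, w', hwu, hw'w.symm, Ne.symm hne, rfl⟩] at h5
    omega
  subst hw'u
  have hu : G.degree w' = 4 := by
    have hsum := h.card_eq_add (G.neighborFinset w')
    rw [card_neighborFinset_eq_degree, h1', h2', h3', Finset.card_singleton] at hsum
    exact hsum
  obtain ⟨x, hxC, h1'', h2'', -, -⟩ :=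
    key h hvC huC hu (fun w hw hw₁ hw₂ => hbad w hw hw₂ hw₁) h3'
  have hx : x ∈ G.neighborFinset w' ∩ C := by
    have : w' ∈ G.neighborFinset x ∩ C := h1''.ge (Finset.mem_singleton_self w')
    rw [Finset.mem_inter, mem_neighborFinset] at this ⊢
    exact ⟨this.1.symm, hxC⟩
  rw [h1', Finset.mem_singleton] at hx
  subst hx
  omega

end IsFourCut

/-- In a `4`-connected graph in which every edge at a vertex of degree four lies in a four-cut,
each such edge forms a triangle with another vertex of degree four. -/
theorem exists_common_neighbor_of_forall_isFourCut {V : Type} [Fintype V] [DecidableEq V]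
    {G : SimpleGraph V} [DecidableRel G.Adj] (hG : IsKConnected 4 G)
    (hcut : ∀ x y, G.Adj x y → G.degree y = 4 → ∃ D T D', IsFourCut G D T D' ∧ x ∈ T ∧ y ∈ T)
    {u v : V} (huv : G.Adj u v) (hv : G.degree v = 4) :
    ∃ w, G.degree w = 4 ∧ G.Adj v w ∧ G.Adj u w := by
  by_contra! hbad
  have hpos : ∀ {X C Y : Finset V} {x : V}, IsFourCut G X C Y → x ∈ C →
      0 < (G.neighborFinset x ∩ X).card := fun h hx => by
    obtain ⟨y, hy, hxy⟩ := h.exists_adj_left hG hx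
    exact Finset.card_pos.mpr ⟨y, by simpa using ⟨hxy, hy⟩⟩
  obtain ⟨X, C, Y, h, huC, hvC, hone⟩ : ∃ X C Y, IsFourCut G X C Y ∧ u ∈ C ∧ v ∈ C ∧
      (G.neighborFinset v ∩ X).card = 1 := by
    obtain ⟨X, C, Y, h, huC, hvC⟩ := hcut u v huv hv
    have h1 := hpos h hvC
    have h2 := hpos h.symm hvC
    have h3 : 0 < (G.neighborFinset v ∩ C).card :=
      Finset.card_pos.mpr ⟨u, by simpa using ⟨huv.symm, huC⟩⟩
    have h4 := h.card_eq_add (G.neighborFinset v)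
    rw [card_neighborFinset_eq_degree, hv] at h4
    rcases (show (G.neighborFinset v ∩ X).card = 1 ∨ (G.neighborFinset v ∩ Y).card = 1 by omega)
      with h5 | h5
    · exact ⟨X, C, Y, h, huC, hvC, h5⟩
    · exact ⟨Y, C, X, h.symm, huC, hvC, h5⟩
  obtain ⟨huC', huX, huY, hua⟩ :=
    h.neighborFinset_of_no_common_neighbor hG hcut huv hv hbad huC hvC hone
  have hu : G.degree u = 4 := by
    have hsum := h.card_eq_add (G.neighborFinset u)
    rwa [card_neighborFinset_eq_degree, huC', huX, huY, Finset.card_singleton] at hsum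
  have hbad' : ∀ w, G.degree w = 4 → G.Adj u w → ¬ G.Adj v w :=
    fun w hw hw₁ hw₂ => hbad w hw hw₂ hw₁
  obtain ⟨-, -, -, hvt⟩ :=
    h.symm.neighborFinset_of_no_common_neighbor hG hcut huv.symm hu hbad' hvC huC huY
  obtain ⟨a, ha⟩ := Finset.card_eq_one.mp hone
  have ha' : G.Adj v a ∧ a ∈ X := by simpa using ha.ge (Finset.mem_singleton_self a)
  obtain ⟨t, ht⟩ := Finset.card_eq_one.mp huY
  have ht' : G.Adj u t ∧ t ∈ Y := by simpa using ht.ge (Finset.mem_singleton_self t)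
  have hau := hua a ha'.2 ha'.1
  have htv := hvt t ht'.2 ht'.1
  obtain ⟨f, hf, hfa⟩ : ∃ f ∈ G.neighborFinset u ∩ X, f ≠ a :=
    Finset.exists_mem_ne (by omega) a
  rw [Finset.mem_inter, mem_neighborFinset] at hf
  have hNu : ∀ x, G.Adj u x → x = v ∨ x = a ∨ x = f ∨ x = t := by
    intro x hx
    have hx' : x ∈ G.neighborFinset u := by simpa using hx
    rcases h.cover x with hxX | hxC | hxY
    · have : ({a, f} : Finset V) = G.neighborFinset u ∩ X := by
        refine Finset.eq_of_subset_of_card_le (fun y hy => ?_) ?_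
        · simp only [Finset.mem_insert, Finset.mem_singleton] at hy
          rcases hy with rfl | rfl
          · simpa using ⟨hau, ha'.2⟩
          · simpa using hf
        · rw [huX, Finset.card_pair hfa.symm]
      have := this.ge (Finset.mem_inter.mpr ⟨hx', hxX⟩)
      simp only [Finset.mem_insert, Finset.mem_singleton] at this
      tauto
    · exact .inl (by simpa using huC'.le (Finset.mem_inter.mpr ⟨hx', hxC⟩))
    · exact .inr (.inr (.inr (by simpa using ht.le (Finset.mem_inter.mpr ⟨hx', hxY⟩))))
  obtain ⟨D, R, D', h', hfR, huR⟩ := hcut f u hf.1.symm hu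
  have hfD : ∀ {D D' : Finset V}, IsFourCut G D R D' → f ∉ D := fun h'' hfD =>
    (h''.notMem_of_mem_left hfD).1 hfR
  have hvR : v ∈ R := by
    have aux : ∀ {D D' : Finset V}, IsFourCut G D R D' → v ∉ D := by
      intro D D' h'' hvD
      obtain ⟨x, hx, hux⟩ := h''.exists_adj_right hG huR
      rcases hNu x hux with rfl | rfl | rfl | rfl
      · exact (h''.notMem_of_mem_left hvD).2 hx
      · exact h''.not_adj v hvD x hx ha'.1
      · exact hfD h''.symm hx
      · exact h''.not_adj v hvD x hx htv
    exact ((h'.cover v).resolve_left (aux h')).resolve_right (aux h'.symm)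
  have hcard : (G.neighborFinset u ∩ D).card = 1 ∧ (G.neighborFinset u ∩ D').card = 1 := by
    have h1 := hpos h' huR
    have h2 := hpos h'.symm huR
    have h3 : 2 ≤ (G.neighborFinset u ∩ R).card := by
      have hvf : v ≠ f := fun hvf => (h.notMem_of_mem_left hf.2).1 (hvf ▸ hvC)
      rw [← Finset.card_pair hvf]
      refine Finset.card_le_card fun x hx => ?_
      rw [Finset.mem_insert, Finset.mem_singleton] at hx
      rcases hx with rfl | rfl
      · simpa using ⟨huv, hvR⟩
      · simpa using ⟨hf.1, hfR⟩
    have h4 := h'.card_eq_add (G.neighborFinset u)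
    rw [card_neighborFinset_eq_degree, hu] at h4
    omega
  obtain ⟨-, h1, -, -⟩ :=
    h'.neighborFinset_of_no_common_neighbor hG hcut huv.symm hu hbad' hvR huR hcard.1
  obtain ⟨-, -, h2, -⟩ :=
    h'.symm.neighborFinset_of_no_common_neighbor hG hcut huv.symm hu hbad' hvR huR hcard.2
  omega

theorem contractEdge_adj_of_adj {V : Type} {G : SimpleGraph V} {u v : V} {x y : {x : V // x ≠ v}}
    (hxy : G.Adj x y) : (contractEdge G u v).Adj x y :=
  (fromRel_adj _ _ _).mpr ⟨fun h => G.ne_of_adj hxy (congrArg _ h), .inl (.inl hxy)⟩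

theorem contractEdge_adj_left {V : Type} {G : SimpleGraph V} {u v : V} (huv : u ≠ v)
    {y : {x : V // x ≠ v}} (hy : (y : V) ≠ u) (hvy : G.Adj v y) :
    (contractEdge G u v).Adj ⟨u, huv⟩ y :=
  (fromRel_adj _ _ _).mpr ⟨fun h => hy (congrArg Subtype.val h).symm, .inl (.inr ⟨rfl, hvy⟩)⟩

theorem isMinor_contractEdge {V : Type} {G : SimpleGraph V} {u v : V} (huv : G.Adj u v) :
    IsMinor (contractEdge G u v) G := by
  classical
  refine ⟨fun x => {(x : V), if (x : V) = u then v else x}, fun x => ?_, fun x y hxy => ?_,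
    fun x y hxy => ?_⟩
  · refine induce_pair_connected ?_
    split_ifs with hx
    · exact .inr (hx ▸ huv)
    · exact .inl rfl
  · have hne : (x : V) ≠ y := fun h => hxy (Subtype.ext h)
    have hx := x.2
    have hy := y.2
    rw [Set.disjoint_left]
    simp only [Set.mem_insert_iff, Set.mem_singleton_iff]
    grind
  · rcases ((fromRel_adj _ _ _).mp hxy).2 with (h | ⟨hx, h⟩) | (h | ⟨hy, h⟩)
    · exact ⟨x, by simp, y, by simp, h⟩
    · exact ⟨v, by simp [hx], y, by simp, h⟩
    · exact ⟨x, by simp, y, by simp, h.symm⟩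
    · exact ⟨x, by simp, v, by simp [hy], h.symm⟩

theorem exists_isFourCut_of_contractEdge {V : Type} [Fintype V] {G : SimpleGraph V} {u v : V}
    (hG : IsKConnected 4 G) (hV : 6 ≤ Fintype.card V) (huv : G.Adj u v)
    (hcon : ¬ ∀ S : Set {x : V // x ≠ v}, S.ncard < 4 →
      ((contractEdge G u v).induce Sᶜ).Connected) :
    ∃ D T D', IsFourCut G D T D' ∧ u ∈ T ∧ v ∈ T := by
  classical
  push Not at hcon
  obtain ⟨S, hS, hcon⟩ := hcon
  have huv' := G.ne_of_adj huv
  have hcard : Fintype.card {x : V // x ≠ v} + 1 = Fintype.card V := by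
    rw [Fintype.card_subtype_compl, Fintype.card_subtype_eq]
    omega
  have hne : (Sᶜ).Nonempty := by
    rw [Set.nonempty_compl]
    rintro rfl
    rw [Set.ncard_univ, Nat.card_eq_fintype_card] at hS
    omega
  rw [induce_connected_iff_forall_closed] at hcon
  push Not at hcon
  obtain ⟨A, hA, ⟨⟨x, hxv⟩, hxA⟩, hcl, hSA⟩ := hcon hne
  obtain ⟨⟨z, hzv⟩, hzS, hzA⟩ := Set.not_subset.mp hSA
  have hstep : ∀ (x : V) (hx : x ≠ v) (y : V) (hy : y ≠ v), (⟨x, hx⟩ : {x : V // x ≠ v}) ∈ A →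
      (contractEdge G u v).Adj ⟨x, hx⟩ ⟨y, hy⟩ →
      (⟨y, hy⟩ : {x : V // x ≠ v}) ∈ A ∨ (⟨y, hy⟩ : {x : V // x ≠ v}) ∈ S := fun x hx y hy hxA hadj =>
    or_iff_not_imp_right.mpr fun hyS => hcl _ hxA _ hyS hadj
  set X : Finset V := Finset.univ.filter fun y => ∃ hy : y ≠ v, (⟨y, hy⟩ : {x : V // x ≠ v}) ∈ A
    with hX
  set N : Finset V := S.toFinset.map (Function.Embedding.subtype _) with hN
  have hmemX : ∀ (y : V) (hy : y ≠ v), y ∈ X ↔ (⟨y, hy⟩ : {x : V // x ≠ v}) ∈ A := by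
    intro y hy
    simp [hX, hy]
  have hmemN : ∀ (y : V) (hy : y ≠ v), y ∈ N ↔ (⟨y, hy⟩ : {x : V // x ≠ v}) ∈ S := by
    intro y hy
    simp [hN, hy]
  have hvX : v ∉ X := by simp [hX]
  have hvN : v ∉ N := by simp [hN]
  have hNcard : N.card < 4 := by
    rwa [hN, Finset.card_map, ← Set.ncard_eq_toFinset_card']
  clear_value X N
  have hXN : Disjoint X N := by
    rw [Finset.disjoint_left]
    intro y hyX hyN
    have hy : y ≠ v := fun h => hvX (h ▸ hyX)
    exact hA ((hmemX y hy).mp hyX) ((hmemN y hy).mp hyN)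
  have hxX : x ∈ X := (hmemX x hxv).mpr hxA
  have hzX : z ∉ X := fun h => hzA ((hmemX z hzv).mp h)
  have hzN : z ∉ N := fun h => hzS ((hmemN z hzv).mp h)
  have hstep' : ∀ y ∈ X, ∀ y', G.Adj y y' → y' ≠ v → y' ∈ X ∨ y' ∈ N := by
    intro y hy y' hadj hy'
    have hyv : y ≠ v := fun h => hvX (h ▸ hy)
    rw [hmemX _ hyv] at hy
    rw [hmemX _ hy', hmemN _ hy']
    exact hstep y hyv y' hy' hy (contractEdge_adj_of_adj hadj)
  have huN : u ∈ N := by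
    by_contra huN
    suffices ∃ X' : Finset V, x ∈ X' ∧ z ∉ X' ∧
        ∀ y ∈ X', ∀ y', G.Adj y y' → y' ∈ X' ∨ y' ∈ N by
      obtain ⟨X', hx', hz', hcl'⟩ := this
      exact absurd (hG.four_le_card ⟨x, hx', Finset.disjoint_left.mp hXN hxX⟩ hcl' ⟨z, hz', hzN⟩)
        (by omega)
    by_cases huX : u ∈ X
    · refine ⟨insert v X, Finset.mem_insert_of_mem hxX, by simp [hzv, hzX], ?_⟩
      intro y hy y' hadj
      by_cases hy'v : y' = v
      · exact .inl (hy'v ▸ Finset.mem_insert_self _ _)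
      rcases Finset.mem_insert.mp hy with rfl | hy
      · by_cases hy'u : y' = u
        · exact .inl (hy'u ▸ Finset.mem_insert_of_mem huX)
        · have := hstep u huv' y' hy'v ((hmemX _ huv').mp huX)
            (contractEdge_adj_left huv' hy'u hadj)
          rw [← hmemX, ← hmemN] at this
          exact this.imp_left Finset.mem_insert_of_mem
      · exact (hstep' y hy y' hadj hy'v).imp_left Finset.mem_insert_of_mem
    · refine ⟨X, hxX, hzX, ?_⟩
      intro y hy y' hadj
      by_cases hy'v : y' = v
      · subst hy'v
        have hyv : y ≠ y' := G.ne_of_adj hadj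
        have hyu : y ≠ u := fun h => huX (h ▸ hy)
        have := hstep y hyv u huv' ((hmemX _ hyv).mp hy)
          (contractEdge_adj_left huv' hyu hadj.symm).symm
        rw [← hmemX, ← hmemN] at this
        tauto
      · exact hstep' y hy y' hadj hy'v
  have hcl' : ∀ y ∈ X, ∀ y', G.Adj y y' → y' ∈ X ∨ y' ∈ insert v N := by
    intro y hy y' hadj
    by_cases hy'v : y' = v
    · exact .inr (hy'v ▸ Finset.mem_insert_self _ _)
    · exact (hstep' y hy y' hadj hy'v).imp_right Finset.mem_insert_of_mem
  have hdisj : Disjoint X (insert v N) := by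
    rw [Finset.disjoint_insert_right]
    exact ⟨hvX, hXN⟩
  have hzvN : z ∉ insert v N := by simp [hzv, hzN]
  refine ⟨X, insert v N, (X ∪ insert v N)ᶜ, ⟨fun y => ?_, hdisj, ?_, ?_, ?_, ⟨x, hxX⟩, ⟨z, ?_⟩, ?_⟩,
    Finset.mem_insert_of_mem huN, Finset.mem_insert_self _ _⟩
  · rw [Finset.mem_compl, Finset.mem_union]
    tauto
  · exact (disjoint_compl_right (a := X ∪ insert v N)).symm.mono_right Finset.subset_union_right
  · exact (disjoint_compl_right (a := X ∪ insert v N)).mono_left Finset.subset_union_left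
  · intro y hy y' hy' hadj
    rw [Finset.mem_compl, Finset.mem_union] at hy'
    exact hy' (hcl' y hy y' hadj)
  · rw [Finset.mem_compl, Finset.mem_union]
    tauto
  · have h1 := hG.four_le_card ⟨x, hxX, Finset.disjoint_left.mp hdisj hxX⟩ hcl' ⟨z, hzX, hzvN⟩
    rw [Finset.card_insert_of_notMem hvN] at h1 ⊢
    omega

theorem ncard_edgeSet_le_add_degree {V : Type} [Fintype V] (G : SimpleGraph V)
    [DecidableRel G.Adj] (v : V) :
    G.edgeSet.ncard ≤
      (G.comap (Subtype.val : {x : V // x ≠ v} → V)).edgeSet.ncard + G.degree v := by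
  classical
  have hsub : G.edgeSet ⊆ Sym2.map Subtype.val ''
      (G.comap (Subtype.val : {x : V // x ≠ v} → V)).edgeSet ∪ G.incidenceSet v := by
    intro e he
    by_cases hv : v ∈ e
    · exact .inr ⟨he, hv⟩
    · left
      induction e with
      | _ x y =>
        rw [Sym2.mem_iff, not_or] at hv
        exact ⟨s(⟨x, Ne.symm hv.1⟩, ⟨y, Ne.symm hv.2⟩), he, rfl⟩
  calc G.edgeSet.ncard ≤ _ := Set.ncard_le_ncard hsub
    _ ≤ _ := Set.ncard_union_le _ _
    _ ≤ _ := by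
      gcongr
      · exact Set.ncard_image_le
      · rw [Set.ncard_eq_toFinset_card', Set.toFinset_card, card_incidenceSet_eq_degree]

theorem ncard_edgeSet_K2222 : K2222.edgeSet.ncard = 24 := by
  have : DecidableRel K2222.Adj := fun p q => inferInstanceAs (Decidable (p.1 ≠ q.1))
  have hdeg : ∀ p, K2222.degree p = 6 := by
    intro p
    rw [← card_neighborFinset_eq_degree, show K2222.neighborFinset p =
      Finset.univ.filter fun q : Fin 4 × Fin 2 => p.1 ≠ q.1 by
        ext; rw [mem_neighborFinset]; simp [K2222]]
    revert p
    decide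
  have hsum := K2222.sum_degrees_eq_twice_card_edges
  simp only [hdeg, Finset.sum_const, Finset.card_univ, Fintype.card_prod, Fintype.card_fin,
    smul_eq_mul] at hsum
  rw [Set.ncard_eq_toFinset_card', Set.toFinset_card, ← edgeFinset_card]
  omega

/-- `K2222` together with a further vertex `none` whose neighbourhood is `P`. -/
def K2222Cone (P : Finset (Fin 4 × Fin 2)) : SimpleGraph (Option (Fin 4 × Fin 2)) where
  Adj
    | some p, some q => p.1 ≠ q.1
    | none, some q => q ∈ P
    | some p, none => p ∈ P
    | none, none => False
  symm := ⟨by rintro (_ | p) (_ | q) h <;> first | exact h | exact Ne.symm h⟩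
  loopless := ⟨by rintro (_ | p) h <;> first | exact h | exact h rfl⟩

instance (P : Finset (Fin 4 × Fin 2)) : DecidableRel (K2222Cone P).Adj
  | some p, some q => inferInstanceAs (Decidable (p.1 ≠ q.1))
  | none, some q => inferInstanceAs (Decidable (q ∈ P))
  | some p, none => inferInstanceAs (Decidable (p ∈ P))
  | none, none => inferInstanceAs (Decidable False)

theorem isMinor_of_pairs {W V : Type} {H : SimpleGraph W} {G : SimpleGraph V} (f g : W → V)
    (hfg : ∀ w, f w = g w ∨ G.Adj (f w) (g w))
    (hne : ∀ w w', w ≠ w' → f w ≠ f w' ∧ f w ≠ g w' ∧ g w ≠ f w' ∧ g w ≠ g w')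
    (hadj : ∀ w w', H.Adj w w' → G.Adj (f w) (f w') ∨ G.Adj (f w) (g w') ∨ G.Adj (g w) (f w') ∨
      G.Adj (g w) (g w')) : IsMinor H G := by
  refine ⟨fun w => {f w, g w}, fun w => induce_pair_connected (hfg w), fun w w' hw => ?_,
    fun w w' hw => ?_⟩
  · have := hne w w' hw
    simp only [Set.disjoint_left, Set.mem_insert_iff, Set.mem_singleton_iff]
    grind
  · rcases hadj w w' hw with h | h | h | h
    · exact ⟨f w, by simp, f w', by simp, h⟩
    · exact ⟨f w, by simp, g w', by simp, h⟩
    · exact ⟨g w, by simp, f w', by simp, h⟩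
    · exact ⟨g w, by simp, g w', by simp, h⟩

theorem K7vee_adj_iff (i j : Fin 7) : K7vee.Adj i j ↔
    i ≠ j ∧ s(i, j) ≠ s(0, 1) ∧ s(i, j) ≠ s(0, 2) := by
  simp [K7vee]

theorem isMinor_K7vee_K2222Cone_transversal :
    IsMinor K7vee (K2222Cone {(0, 0), (1, 0), (2, 0), (3, 0)}) := by
  refine isMinor_of_pairs
    ![none, some (1, 1), some (3, 1), some (0, 0), some (0, 1), some (2, 0), some (2, 1)]
    ![none, some (1, 1), some (3, 1), some (0, 0), some (1, 0), some (2, 0), some (3, 0)]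
    ?_ ?_ ?_
  · decide
  · decide
  · simp only [K7vee_adj_iff]
    decide

theorem isMinor_K7vee_K2222Cone_pair : IsMinor K7vee (K2222Cone {(0, 0), (0, 1)}) := by
  refine isMinor_of_pairs
    ![some (3, 0), some (3, 1), some (1, 1), none, some (0, 1), some (1, 0), some (2, 1)]
    ![some (3, 0), some (3, 1), some (1, 1), some (0, 0), some (0, 1), some (2, 0), some (2, 1)]
    ?_ ?_ ?_
  · decide
  · decide
  · simp only [K7vee_adj_iff]
    decide

theorem isMinor_K2222Cone {V : Type} {G : SimpleGraph V} {v : V} {P : Finset (Fin 4 × Fin 2)}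
    {ψ : Fin 4 × Fin 2 → V} (hinj : Function.Injective ψ) (hv : ∀ p, ψ p ≠ v)
    (hadj : ∀ p q, p.1 ≠ q.1 → G.Adj (ψ p) (ψ q)) (hP : ∀ p ∈ P, G.Adj v (ψ p)) :
    IsMinor (K2222Cone P) G := by
  have hinj' : ∀ x y : Option (Fin 4 × Fin 2), x ≠ y → x.elim v ψ ≠ y.elim v ψ := by
    rintro (_ | p) (_ | q) h
    · exact absurd rfl h
    · exact (hv q).symm
    · exact hv p
    · exact fun h' => h (congrArg some (hinj h'))
  refine isMinor_of_pairs (fun x => x.elim v ψ) (fun x => x.elim v ψ) (fun _ => .inl rfl)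
    (fun x y hxy => ⟨hinj' x y hxy, hinj' x y hxy, hinj' x y hxy, hinj' x y hxy⟩) ?_
  rintro (_ | p) (_ | q) h
  · exact h.elim
  · exact .inl (hP q h)
  · exact .inl (hP p h).symm
  · exact .inl (hadj p q h)

/-- Adding a vertex of degree four to `K2222` creates a `K7vee`-minor. -/
theorem isMinor_K7vee_of_degree_eq_four {V : Type} [Fintype V] {G : SimpleGraph V}
    [DecidableRel G.Adj] {v : V} (hv : G.degree v = 4)
    (φ : G.comap (Subtype.val : {x : V // x ≠ v} → V) ≃g K2222) : IsMinor K7vee G := by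
  classical
  set ψ : Fin 4 × Fin 2 → V := fun p => φ.symm p with hψ
  have hinj : Function.Injective ψ := Subtype.val_injective.comp φ.symm.injective
  have hψv : ∀ p, ψ p ≠ v := fun p => (φ.symm p).2
  have hadj : ∀ p q, p.1 ≠ q.1 → G.Adj (ψ p) (ψ q) := fun p q hpq =>
    φ.symm.map_rel_iff.mpr (show K2222.Adj p q from hpq)
  by_cases hpair : ∃ j, ∀ e, G.Adj v (ψ (j, e))
  · obtain ⟨j, hj⟩ := hpair
    refine isMinor_K7vee_K2222Cone_pair.trans (isMinor_K2222Cone (v := v)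
      (ψ := fun p => ψ (Equiv.swap 0 j p.1, p.2)) ?_ (fun p => hψv _) ?_ ?_)
    · intro p q hpq
      simpa [Prod.ext_iff] using hinj hpq
    · intro p q hpq
      exact hadj _ _ (by simpa using hpq)
    · intro p hp
      simp only [Finset.mem_insert, Finset.mem_singleton] at hp
      rcases hp with rfl | rfl <;> simpa using hj _
  · have htrans : ∀ i, ∃ e, G.Adj v (ψ (i, e)) := by
      set P : Finset (Fin 4 × Fin 2) := Finset.univ.filter fun p => G.Adj v (ψ p) with hP
      have hcard : P.card = 4 := by
        refine Eq.trans ?_ hv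
        rw [← card_neighborFinset_eq_degree, ← Finset.card_image_of_injective P hinj]
        congr 1
        ext x
        simp only [hP, Finset.mem_image, Finset.mem_filter, Finset.mem_univ, true_and,
          mem_neighborFinset]
        constructor
        · rintro ⟨p, hp, rfl⟩
          exact hp
        · intro hx
          refine ⟨φ ⟨x, (G.ne_of_adj hx).symm⟩, ?_, ?_⟩ <;> simp [hψ, hx]
      have hfst : Set.InjOn Prod.fst (P : Set (Fin 4 × Fin 2)) := by
        rintro ⟨i, e⟩ hp ⟨i', e'⟩ hq (rfl : i = i')
        by_contra hne
        refine hpair ⟨i, fun e'' => ?_⟩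
        have h1 : G.Adj v (ψ (i, e)) := by simpa [hP] using hp
        have h2 : G.Adj v (ψ (i, e')) := by simpa [hP] using hq
        have h3 : e'' = e ∨ e'' = e' := by
          have : e ≠ e' := fun h => hne (by rw [h])
          omega
        rcases h3 with rfl | rfl <;> assumption
      have himage : P.image Prod.fst = Finset.univ := by
        rw [← Finset.card_eq_iff_eq_univ, Finset.card_image_of_injOn hfst, hcard, Fintype.card_fin]
      intro i
      obtain ⟨⟨i', e⟩, hp, rfl⟩ := Finset.mem_image.mp (himage.ge (Finset.mem_univ i))
      exact ⟨e, by simpa [hP] using hp⟩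
    choose c hc using htrans
    refine isMinor_K7vee_K2222Cone_transversal.trans (isMinor_K2222Cone (v := v)
      (ψ := fun p => ψ (p.1, p.2 + c p.1)) ?_ (fun p => hψv _) ?_ ?_)
    · rintro ⟨i, e⟩ ⟨i', e'⟩ hpq
      have h1 := Prod.ext_iff.mp (hinj hpq)
      obtain rfl : i = i' := h1.1
      exact Prod.ext rfl (add_right_cancel h1.2)
    · exact fun p q hpq => hadj _ _ hpq
    · intro p hp
      simp only [Finset.mem_insert, Finset.mem_singleton] at hp
      rcases hp with rfl | rfl | rfl | rfl <;> simpa using hc _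

theorem Enemy.six_le_card {V : Type} [Fintype V] {G : SimpleGraph V} (h : Enemy G) :
    6 ≤ Fintype.card V := by
  classical
  have h1 := h.1.1
  have h2 := h.2.1
  have h3 := G.card_edgeFinset_le_card_choose_two
  rw [← Set.ncard_coe_finset, coe_edgeFinset] at h3
  by_contra! hlt
  rw [show Fintype.card V = 5 by omega] at h2 h3
  norm_num [Nat.choose] at h2 h3
  omega

theorem MinorMinimalEnemy.exists_isFourCut {V : Type} [Fintype V] {G : SimpleGraph V}
    [DecidableRel G.Adj] (h : MinorMinimalEnemy G) {u v : V} (huv : G.Adj u v)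
    (hv : G.degree v = 4) : ∃ D T D', IsFourCut G D T D' ∧ u ∈ T ∧ v ∈ T := by
  classical
  obtain ⟨⟨hconn, hedge, hK7, -⟩, hmin⟩ := id h
  have hV := h.1.six_le_card
  have hcard : Fintype.card {x : V // x ≠ v} + 1 = Fintype.card V := by
    rw [Fintype.card_subtype_compl, Fintype.card_subtype_eq]
    omega
  by_contra hno
  have hle : G.comap (Subtype.val : {x : V // x ≠ v} → V) ≤ contractEdge G u v :=
    fun x y hxy => contractEdge_adj_of_adj hxy
  have hdel := ncard_edgeSet_le_add_degree G v
  have hmono : (G.comap (Subtype.val : {x : V // x ≠ v} → V)).edgeSet.ncard ≤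
      (contractEdge G u v).edgeSet.ncard := Set.ncard_le_ncard (edgeSet_subset_edgeSet.mpr hle)
  have henemy : Enemy (contractEdge G u v) := by
    refine ⟨⟨by omega, ?_⟩, by omega, fun hm => hK7 (hm.trans (isMinor_contractEdge huv)), ⟨?_⟩⟩
    · by_contra hcon
      exact hno (exists_isFourCut_of_contractEdge hconn hV huv hcon)
    · intro φ
      have h8 : Fintype.card {x : V // x ≠ v} = 8 := Fintype.card_congr φ.toEquiv
      have h24 : (contractEdge G u v).edgeSet.ncard = 24 := by
        rw [← ncard_edgeSet_K2222, ← Nat.card_coe_set_eq, ← Nat.card_coe_set_eq]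
        exact Nat.card_congr φ.mapEdgeSet
      have heq : G.comap (Subtype.val : {x : V // x ≠ v} → V) = contractEdge G u v :=
        edgeSet_injective (Set.eq_of_subset_of_ncard_le (edgeSet_subset_edgeSet.mpr hle) (by omega))
      rw [← heq] at φ
      exact hK7 (isMinor_K7vee_of_degree_eq_four hv φ)
  obtain ⟨φ⟩ := hmin _ _ (isMinor_contractEdge huv) henemy
  have := Fintype.card_congr φ.toEquiv
  omega

/-- in a minor-minimal enemy, for an edge `uv` with `deg v = 4` there is a
vertex `w` of degree 4 adjacent to both `v` and `u`. -/
theorem statement_10 (V : Type) [Fintype V] (G : SimpleGraph V) [DecidableRel G.Adj]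
    (h : MinorMinimalEnemy G) (u v : V) (huv : G.Adj u v) (hv : G.degree v = 4) :
    ∃ w : V, G.degree w = 4 ∧ G.Adj v w ∧ G.Adj u w := by
  classical
  exact exists_common_neighbor_of_forall_isFourCut h.1.1
    (fun _ _ hxy hy => h.exists_isFourCut hxy hy) huv hv
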